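/- By symmetry between the buyer and the seller, FB ≤ 8·SP + 2·BuyerP. -/

import Mathlib

open MeasureTheory Set

lemma aux_conv (ν₁ ν₂ : Measure ℝ) [IsProbabilityMeasure ν₁] [IsProbabilityMeasure ν₂]
    (h₁ : ν₁.restrict (Icc 0 1) = ν₁) (hae : ∀ᵐ x ∂ν₁, x ∈ Icc (0:ℝ) 1)
    (s : ℝ → Set ℝ) (hs : MeasurableSet {p : ℝ × ℝ | p.2 ∈ s p.1})
    (f : ℝ → ℝ → ℝ) (hf : Measurable (Function.uncurry f))
    (hb : ∀ x ∈ Icc (0:ℝ) 1, ∀ y ∈ s x, 0 ≤ f x y ∧ f x y ≤ 1) :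
    ENNReal.ofReal (∫ x in Icc (0:ℝ) 1, (∫ y in s x, f x y ∂ν₂) ∂ν₁)
      = ∫⁻ x, (∫⁻ y in s x, ENNReal.ofReal (f x y) ∂ν₂) ∂ν₁ := by
  rw [h₁]
  have hsx : ∀ x, MeasurableSet (s x) := fun x => measurable_prodMk_left (x := x) hs
  have hfx : ∀ x, Measurable (f x) := fun x => hf.comp measurable_prodMk_left
  have hint : ∀ x ∈ Icc (0:ℝ) 1, Integrable (f x) (ν₂.restrict (s x)) := by
    intro x hx
    refine Integrable.of_bound (hfx x).aestronglyMeasurable 1 ?_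
    filter_upwards [ae_restrict_mem (hsx x)] with y hy
    rw [Real.norm_eq_abs, abs_of_nonneg (hb x hx y hy).1]
    exact (hb x hx y hy).2
  have hnn : ∀ x ∈ Icc (0:ℝ) 1, 0 ≤ ∫ y in s x, f x y ∂ν₂ := fun x hx =>
    setIntegral_nonneg (hsx x) fun y hy => (hb x hx y hy).1
  have hmeas : StronglyMeasurable (fun x => ∫ y in s x, f x y ∂ν₂) := by
    have h : StronglyMeasurable (fun x => ∫ y, ({p : ℝ × ℝ | p.2 ∈ s p.1}.indicator
        (Function.uncurry f)) (x, y) ∂ν₂) := by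
      apply StronglyMeasurable.integral_prod_right'
      exact (hf.indicator hs).stronglyMeasurable
    convert h using 2 with x
    rw [← integral_indicator (hsx x)]
    rfl
  rw [ofReal_integral_eq_lintegral_ofReal]
  · apply lintegral_congr_ae
    filter_upwards [hae] with x hx
    rw [ofReal_integral_eq_lintegral_ofReal (hint x hx)]
    filter_upwards [ae_restrict_mem (hsx x)] with y hy
    exact (hb x hx y hy).1
  · refine Integrable.of_bound hmeas.aestronglyMeasurable 1 ?_
    filter_upwards [hae] with x hx
    rw [Real.norm_eq_abs, abs_of_nonneg (hnn x hx)]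
    calc ∫ y in s x, f x y ∂ν₂ ≤ ∫ y in s x, (1:ℝ) ∂ν₂ :=
          setIntegral_mono_on (hint x hx) (integrable_const _) (hsx x)
            fun y hy => (hb x hx y hy).2
      _ ≤ 1 := by
          simp only [integral_const, smul_eq_mul, mul_one]
          rw [measureReal_restrict_apply_univ]
          exact measureReal_le_one
  · filter_upwards [hae] with x hx
    exact hnn x hx

lemma aux_supp (ν : Measure ℝ) [IsProbabilityMeasure ν]
    (F : ℝ → ℝ) (hF : ∀ x, F x = (ν (Iic x)).toReal) (hF0 : F 0 = 0) (hF1 : F 1 = 1) :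
    ∀ᵐ x ∂ν, x ∈ Icc (0:ℝ) 1 := by
  have h0 : ν (Iic 0) = 0 := by
    have := hF 0
    rw [hF0] at this
    rcases (ENNReal.toReal_eq_zero_iff _).1 this.symm with h | h
    · exact h
    · exact absurd h (measure_ne_top _ _)
  have h1 : ν (Iic 1) = 1 := by
    rw [← ENNReal.ofReal_toReal (measure_ne_top ν (Iic 1)), ← hF 1, hF1]; simp
  have h0' : ∀ᵐ x ∂ν, x ∉ Iic (0:ℝ) := measure_eq_zero_iff_ae_notMem.1 h0
  have h1' : ∀ᵐ x ∂ν, x ∈ Iic (1:ℝ) := (prob_compl_eq_zero_iff measurableSet_Iic).2 h1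
  filter_upwards [h0', h1'] with x hx hx'
  exact ⟨(not_le.1 hx).le, hx'⟩

lemma aux_ofReal (ν : Measure ℝ) [IsProbabilityMeasure ν]
    (F : ℝ → ℝ) (hF : ∀ x, F x = (ν (Iic x)).toReal) (x : ℝ) :
    ν (Iic x) = ENNReal.ofReal (F x) := by
  rw [hF, ENNReal.ofReal_toReal (measure_ne_top _ _)]

lemma aux_Ioc (ν : Measure ℝ) [IsProbabilityMeasure ν]
    (F : ℝ → ℝ) (hF : ∀ x, F x = (ν (Iic x)).toReal) (a b : ℝ) (hab : a ≤ b) :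
    ν (Ioc a b) = ENNReal.ofReal (F b - F a) := by
  have h : Ioc a b = Iic b \ Iic a := by ext x; simp [and_comm]
  rw [h, measure_sdiff (Iic_subset_Iic.2 hab) measurableSet_Iic.nullMeasurableSet
    (measure_ne_top _ _), aux_ofReal ν F hF, aux_ofReal ν F hF, ENNReal.ofReal_sub]
  rw [hF]; positivity

lemma aux_Ioi (ν : Measure ℝ) [IsProbabilityMeasure ν]
    (F : ℝ → ℝ) (hF : ∀ x, F x = (ν (Iic x)).toReal) (a : ℝ) :
    ν (Ioi a) = ENNReal.ofReal (1 - F a) := by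
  rw [← compl_Iic, prob_compl_eq_one_sub measurableSet_Iic, aux_ofReal ν F hF,
    ENNReal.ofReal_sub, ENNReal.ofReal_one]
  rw [hF]; positivity

lemma aux_mono (ν : Measure ℝ) [IsProbabilityMeasure ν]
    (F : ℝ → ℝ) (hF : ∀ x, F x = (ν (Iic x)).toReal) : Monotone F := by
  intro a b hab
  rw [hF, hF]
  exact ENNReal.toReal_mono (measure_ne_top _ _) (measure_mono (Iic_subset_Iic.2 hab))

lemma aux_inv (G : ℝ → ℝ) (hGcont : ContinuousOn G (Icc 0 1))
    (hGmono : StrictMonoOn G (Icc 0 1)) (hG0 : G 0 = 0) (hG1 : G 1 = 1) :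
    ∃ H : ℝ → ℝ, Monotone H ∧ (∀ y, H y ∈ Icc (0:ℝ) 1) ∧
      (∀ y, G (H y) = max 0 (min 1 y)) := by
  have h : ∀ y : ℝ, ∃ x ∈ Icc (0:ℝ) 1, G x = max 0 (min 1 y) := by
    intro y
    have := intermediate_value_Icc (zero_le_one' ℝ) hGcont
    rw [hG0, hG1] at this
    exact this ⟨le_max_left _ _, max_le zero_le_one (min_le_left _ _)⟩
  choose H hH hGH using h
  refine ⟨H, ?_, hH, hGH⟩
  intro a b hab
  rw [← hGmono.le_iff_le (hH a) (hH b), hGH, hGH]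
  gcongr

/-- key inequality -/
lemma aux_key (νF νG : Measure ℝ) [IsProbabilityMeasure νF] [IsProbabilityMeasure νG]
    (w : ℝ → ENNReal) (hw : Measurable w) (m d : ℝ → ℝ) (hm : Measurable m) (hd : Measurable d)
    (hmd : ∀ t, νG (Iic t) * νF {v | t < m v} ≤
      2 * ∫⁻ c in {c | c ≤ t ∧ t < d c}, w c ∂νG) :
    ∫⁻ v, ∫⁻ c, ENNReal.ofReal (m v - c) ∂νG ∂νF ≤
      2 * ∫⁻ c, ENNReal.ofReal (d c - c) * w c ∂νG := by
  have e1 : ∀ v, ∫⁻ c, ENNReal.ofReal (m v - c) ∂νG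
      = ∫⁻ t, (Iio (m v)).indicator (fun t => νG (Iic t)) t := by
    intro v
    have : ∀ c, ENNReal.ofReal (m v - c)
        = ∫⁻ t, {p : ℝ × ℝ | p.1 ≤ p.2 ∧ p.2 < m v}.indicator 1 (c, t) := by
      intro c
      rw [← Real.volume_Ico, ← lintegral_indicator_one measurableSet_Ico]
      rfl
    simp_rw [this]
    have hS : MeasurableSet {p : ℝ × ℝ | p.1 ≤ p.2 ∧ p.2 < m v} :=
      (measurableSet_le measurable_fst measurable_snd).inter
        (measurableSet_lt measurable_snd measurable_const)
    rw [lintegral_lintegral_swap]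
    · congr 1 with t
      by_cases ht : t < m v
      · rw [indicator_of_mem (by exact ht), ← lintegral_indicator_one measurableSet_Iic]
        congr 1 with c
        simp [indicator, ht]
      · rw [indicator_of_notMem (by exact ht)]
        simp [indicator, ht]
    · exact (measurable_one.indicator hS).aemeasurable
  have hGm : Measurable (fun t => νG (Iic t)) :=
    Monotone.measurable fun a b hab => measure_mono (Iic_subset_Iic.2 hab)
  have e2 : ∫⁻ v, ∫⁻ c, ENNReal.ofReal (m v - c) ∂νG ∂νF
      = ∫⁻ t, νG (Iic t) * νF {v | t < m v} := by
    simp_rw [e1]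
    rw [lintegral_lintegral_swap]
    · congr 1 with t
      have hS : MeasurableSet {v | t < m v} := measurableSet_lt measurable_const hm
      rw [← lintegral_indicator_const hS]
      rfl
    · have hS : MeasurableSet {p : ℝ × ℝ | p.2 < m p.1} :=
        measurableSet_lt measurable_snd (hm.comp measurable_fst)
      exact ((hGm.comp measurable_snd).indicator hS).aemeasurable
  have e3 : ∫⁻ c, ENNReal.ofReal (d c - c) * w c ∂νG
      = ∫⁻ t, ∫⁻ c in {c | c ≤ t ∧ t < d c}, w c ∂νG := by
    have : ∀ c, ENNReal.ofReal (d c - c) * w c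
        = ∫⁻ t, {p : ℝ × ℝ | p.1 ≤ p.2 ∧ p.2 < d p.1}.indicator (fun p => w p.1) (c, t) := by
      intro c
      rw [← Real.volume_Ico, mul_comm, ← lintegral_indicator_const measurableSet_Ico]
      rfl
    simp_rw [this]
    have hS : MeasurableSet {p : ℝ × ℝ | p.1 ≤ p.2 ∧ p.2 < d p.1} :=
      (measurableSet_le measurable_fst measurable_snd).inter
        (measurableSet_lt measurable_snd (hd.comp measurable_fst))
    rw [lintegral_lintegral_swap]
    · congr 1 with t
      have hS' : MeasurableSet {c | c ≤ t ∧ t < d c} :=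
        measurableSet_Iic.inter (measurableSet_lt measurable_const hd)
      rw [← lintegral_indicator hS']
      rfl
    · exact ((hw.comp measurable_fst).indicator hS).aemeasurable
  rw [e2, e3, ← lintegral_const_mul' _ _ (by simp)]
  exact lintegral_mono hmd

theorem stmt2
    (νF : Measure ℝ) [IsProbabilityMeasure νF]
    (F : ℝ → ℝ) (hFcdf : ∀ x, F x = (νF (Iic x)).toReal)
    (hFcont : ContinuousOn F (Icc 0 1))
    (hFmono : StrictMonoOn F (Icc 0 1))
    (hF0 : F 0 = 0) (hF1 : F 1 = 1)
    (νG : Measure ℝ) [IsProbabilityMeasure νG]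
    (G : ℝ → ℝ) (hGcdf : ∀ x, G x = (νG (Iic x)).toReal)
    (hGcont : ContinuousOn G (Icc 0 1))
    (hGmono : StrictMonoOn G (Icc 0 1))
    (hG0 : G 0 = 0) (hG1 : G 1 = 1)
    (r : ℝ → ℝ) (hrmeas : Measurable r)
    (hrmem : ∀ c ∈ Icc (0:ℝ) 1, r c ∈ Icc (0:ℝ) 1)
    (hrmax : ∀ c ∈ Icc (0:ℝ) 1, ∀ p ∈ Icc (0:ℝ) 1,
      (p - c) * (1 - F p) ≤ (r c - c) * (1 - F (r c)))
    (r' : ℝ → ℝ) (hr'meas : Measurable r')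
    (hr'mem : ∀ v ∈ Icc (0:ℝ) 1, r' v ∈ Icc (0:ℝ) 1)
    (hr'max : ∀ v ∈ Icc (0:ℝ) 1, ∀ p ∈ Icc (0:ℝ) 1,
      (v - p) * G p ≤ (v - r' v) * G (r' v))
    (FB SP BuyerP : ℝ)
    (hFB : FB = ∫ c in Icc (0:ℝ) 1, (∫ v in Icc c 1, (v - c) ∂νF) ∂νG)
    (hSP : SP = ∫ c in Icc (0:ℝ) 1, (∫ v in Icc (r c) 1, (v - c) ∂νF) ∂νG)
    (hBuyerP : BuyerP = ∫ v in Icc (0:ℝ) 1, (∫ c in Icc 0 (r' v), (v - c) ∂νG) ∂νF)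
    : FB ≤ 8 * SP + 2 * BuyerP := by
  have haeF := aux_supp νF F hFcdf hF0 hF1
  have haeG := aux_supp νG G hGcdf hG0 hG1
  have hresF := Measure.restrict_eq_self_of_ae_mem haeF
  have hresG := Measure.restrict_eq_self_of_ae_mem haeG
  have mF := aux_mono νF F hFcdf
  have mG := aux_mono νG G hGcdf
  have one0 : (1:ℝ) ∈ Icc (0:ℝ) 1 := ⟨zero_le_one, le_rfl⟩
  have zero0 : (0:ℝ) ∈ Icc (0:ℝ) 1 := ⟨le_rfl, zero_le_one⟩
  have Gnn : ∀ x, 0 ≤ G x := fun x => by rw [hGcdf]; positivity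
  have Fnn : ∀ x, 0 ≤ F x := fun x => by rw [hFcdf]; positivity
  have Fle : ∀ x, F x ≤ 1 := fun x => by
    rw [hFcdf]; exact measureReal_le_one (μ := νF) (s := Iic x)
  have Gle : ∀ x, G x ≤ 1 := fun x => by
    rw [hGcdf]; exact measureReal_le_one (μ := νG) (s := Iic x)
  have hrc : ∀ c ∈ Icc (0:ℝ) 1, c ≤ r c := by
    intro c hc
    by_contra! h
    have h1 := hrmax c hc c hc
    have h2 := hFmono (hrmem c hc) one0 (h.trans_le hc.2)
    rw [hF1] at h2
    nlinarith
  have hr'v : ∀ v ∈ Icc (0:ℝ) 1, r' v ≤ v := by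
    intro v hv
    by_contra! h
    have h1 := hr'max v hv v hv
    have h2 := hGmono zero0 (hr'mem v hv) (hv.1.trans_lt h)
    rw [hG0] at h2
    nlinarith
  -- conversions
  have cSP : ENNReal.ofReal SP = ∫⁻ c, (∫⁻ v in Icc (r c) 1, ENNReal.ofReal (v - c) ∂νF) ∂νG := by
    rw [hSP]
    refine aux_conv νG νF hresG haeG (fun c => Icc (r c) 1) ?_ (fun c v => v - c)
      (measurable_snd.sub measurable_fst) ?_
    · exact (measurableSet_le (hrmeas.comp measurable_fst) measurable_snd).inter
        (measurableSet_le measurable_snd measurable_const)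
    · intro x hx y hy
      have := hrc x hx
      constructor <;> linarith [hx.1, hx.2, hy.1, hy.2]
  have cBP : ENNReal.ofReal BuyerP
      = ∫⁻ v, (∫⁻ c in Icc 0 (r' v), ENNReal.ofReal (v - c) ∂νG) ∂νF := by
    rw [hBuyerP]
    refine aux_conv νF νG hresF haeF (fun v => Icc 0 (r' v)) ?_ (fun v c => v - c)
      (measurable_fst.sub measurable_snd) ?_
    · exact (measurableSet_le measurable_const measurable_snd).inter
        (measurableSet_le measurable_snd (hr'meas.comp measurable_fst))
    · intro x hx y hy
      have := hr'v x hx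
      constructor <;> linarith [hx.1, hx.2, hy.1, hy.2]
  have cFB : ENNReal.ofReal FB = ∫⁻ c, (∫⁻ v in Icc c 1, ENNReal.ofReal (v - c) ∂νF) ∂νG := by
    rw [hFB]
    refine aux_conv νG νF hresG haeG (fun c => Icc c 1) ?_ (fun c v => v - c)
      (measurable_snd.sub measurable_fst) ?_
    · exact (measurableSet_le measurable_fst measurable_snd).inter
        (measurableSet_le measurable_snd measurable_const)
    · intro x hx y hy
      constructor <;> linarith [hx.1, hx.2, hy.1, hy.2]
  have SPnn : 0 ≤ SP := by
    rw [hSP]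
    refine setIntegral_nonneg measurableSet_Icc fun c hc =>
      setIntegral_nonneg measurableSet_Icc fun v hv => ?_
    linarith [hv.1, hrc c hc]
  have BPnn : 0 ≤ BuyerP := by
    rw [hBuyerP]
    refine setIntegral_nonneg measurableSet_Icc fun v hv =>
      setIntegral_nonneg measurableSet_Icc fun c hc => ?_
    linarith [hc.2, hr'v v hv]
  obtain ⟨H, mH, Hmem, GH⟩ := aux_inv G hGcont hGmono hG0 hG1
  set m : ℝ → ℝ := fun v => H (G v / 2) with hm_def
  set d : ℝ → ℝ := fun c => H (2 * G c) with hd_def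
  have Gm : ∀ v, G (m v) = G v / 2 := by
    intro v
    rw [hm_def]; simp only
    rw [GH, min_eq_right (by linarith [Gle v, Gnn v]), max_eq_right (by linarith [Gnn v])]
  have Gd : ∀ c, G (d c) = min 1 (2 * G c) := by
    intro c
    rw [hd_def]; simp only
    rw [GH, max_eq_right]
    exact le_min zero_le_one (by linarith [Gnn c])
  have mm : Measurable m := mH.measurable.comp (mG.measurable.div_const 2)
  have md : Measurable d := mH.measurable.comp (mG.measurable.const_mul 2)
  -- step 1: buyer
  have bBP : ∀ v ∈ Icc (0:ℝ) 1, ENNReal.ofReal ((v - m v) * G (m v)) ≤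
      ∫⁻ c in Icc 0 (r' v), ENNReal.ofReal (v - c) ∂νG := by
    intro v hv
    calc ENNReal.ofReal ((v - m v) * G (m v))
        ≤ ENNReal.ofReal ((v - r' v) * G (r' v)) :=
          ENNReal.ofReal_le_ofReal (hr'max v hv _ (Hmem _))
      _ = ENNReal.ofReal (v - r' v) * νG (Ioc 0 (r' v)) := by
          rw [ENNReal.ofReal_mul (by linarith [hr'v v hv]),
            aux_Ioc νG G hGcdf _ _ (hr'mem v hv).1, hG0, sub_zero]
      _ ≤ ENNReal.ofReal (v - r' v) * νG (Icc 0 (r' v)) := by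
          gcongr; exact Ioc_subset_Icc_self
      _ = ∫⁻ c in Icc 0 (r' v), ENNReal.ofReal (v - r' v) ∂νG := by
          rw [setLIntegral_const]
      _ ≤ _ := by
          refine setLIntegral_mono' measurableSet_Icc fun c hc => ?_
          exact ENNReal.ofReal_le_ofReal (by linarith [hc.2])
  have bSP : ∀ c ∈ Icc (0:ℝ) 1, ENNReal.ofReal (d c - c) * ENNReal.ofReal (1 - F (d c)) ≤
      ∫⁻ v in Icc (r c) 1, ENNReal.ofReal (v - c) ∂νF := by
    intro c hc
    calc ENNReal.ofReal (d c - c) * ENNReal.ofReal (1 - F (d c))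
        = ENNReal.ofReal ((d c - c) * (1 - F (d c))) := by
          rw [ENNReal.ofReal_mul' (by linarith [Fle (d c)])]
      _ ≤ ENNReal.ofReal ((r c - c) * (1 - F (r c))) :=
          ENNReal.ofReal_le_ofReal (hrmax c hc _ (Hmem _))
      _ = ENNReal.ofReal (r c - c) * νF (Ioc (r c) 1) := by
          rw [ENNReal.ofReal_mul (by linarith [hrc c hc]),
            aux_Ioc νF F hFcdf _ _ (hrmem c hc).2, hF1]
      _ ≤ ENNReal.ofReal (r c - c) * νF (Icc (r c) 1) := by
          gcongr; exact Ioc_subset_Icc_self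
      _ = ∫⁻ v in Icc (r c) 1, ENNReal.ofReal (r c - c) ∂νF := by
          rw [setLIntegral_const]
      _ ≤ _ := by
          refine setLIntegral_mono' measurableSet_Icc fun v hv => ?_
          exact ENNReal.ofReal_le_ofReal (by linarith [hv.1])
  -- key
  have key := aux_key νF νG (fun c => ENNReal.ofReal (1 - F (d c)))
    (measurable_const.sub (mF.measurable.comp md)).ennreal_ofReal m d mm md (by
      intro t
      by_cases ht0 : t < 0
      · have : G t = 0 := le_antisymm (by rw [← hG0]; exact mG ht0.le) (Gnn t)
        rw [aux_ofReal νG G hGcdf, this]; simp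
      by_cases ht1 : 1 ≤ t
      · have : {v | t < m v} = ∅ := by
          ext v; simp only [mem_ofPred_eq, mem_empty_iff_false, iff_false, not_lt]
          exact (Hmem _).2.trans ht1
        rw [this]; simp
      push Not at ht0 ht1
      have ht : t ∈ Icc (0:ℝ) 1 := ⟨ht0, ht1.le⟩
      have Glt : ∀ v, t < m v → 2 * G t < G v := by
        intro v hv
        have := hGmono ht (Hmem _) hv
        have h2 := Gm v
        simp only [hm_def] at h2
        linarith
      by_cases hG2 : 1 ≤ 2 * G t
      · have : {v | t < m v} = ∅ := by
          ext v; simp only [mem_ofPred_eq, mem_empty_iff_false, iff_false]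
          intro hv
          linarith [Glt v hv, Gle v]
        rw [this]; simp
      push Not at hG2
      have hsub : {v | t < m v} ⊆ Ioi (d t) := by
        intro v hv
        have h1 := Glt v hv
        have h2 := Gd t
        rw [min_eq_right hG2.le] at h2
        by_contra h
        have h3 := mG (not_lt.1 h)
        linarith
      have hmt : m t ≤ t := by
        rw [← hGmono.le_iff_le (Hmem _) ht]
        have := Gm t
        simp only [hm_def] at this
        linarith [Gnn t]
      have hS : MeasurableSet {c | c ≤ t ∧ t < d c} :=
        measurableSet_Iic.inter (measurableSet_lt measurable_const md)
      have hsub2 : Ioc (m t) t ⊆ {c | c ≤ t ∧ t < d c} := by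
        intro c hc
        refine ⟨hc.2, ?_⟩
        have hc0 : c ∈ Icc (0:ℝ) 1 := ⟨(Hmem _).1.trans hc.1.le, hc.2.trans ht.2⟩
        have h1 := hGmono (Hmem _) hc0 hc.1
        have h2 := Gm t
        simp only [hm_def] at h2
        have h3 := Gd c
        by_contra h
        have h4 := mG (not_lt.1 h)
        rw [h3] at h4
        have : G t < min 1 (2 * G c) := lt_min (by linarith [Gnn t]) (by linarith)
        linarith
      calc νG (Iic t) * νF {v | t < m v}
          ≤ νG (Iic t) * νF (Ioi (d t)) := by gcongr
        _ = ENNReal.ofReal (G t) * ENNReal.ofReal (1 - F (d t)) := by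
            rw [aux_ofReal νG G hGcdf, aux_Ioi νF F hFcdf]
        _ = 2 * (ENNReal.ofReal (1 - F (d t)) * νG (Ioc (m t) t)) := by
            rw [aux_Ioc νG G hGcdf _ _ hmt, Gm,
              show G t = 2 * (G t - G t / 2) by ring, ENNReal.ofReal_mul (by norm_num)]
            rw [show 2 * (G t - G t / 2) = G t by ring]
            simp only [ENNReal.ofReal_ofNat]
            ring
        _ ≤ 2 * (ENNReal.ofReal (1 - F (d t)) * νG {c | c ≤ t ∧ t < d c}) := by gcongr
        _ = 2 * ∫⁻ c in {c | c ≤ t ∧ t < d c}, ENNReal.ofReal (1 - F (d t)) ∂νG := by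
            rw [setLIntegral_const]
        _ ≤ _ := by
            gcongr 2 * ?_
            refine setLIntegral_mono' hS fun c hc => ?_
            refine ENNReal.ofReal_le_ofReal ?_
            have h1 : d c ≤ d t := mH (by linarith [mG hc.1])
            linarith [mF h1])
  -- FB bound
  have bFB : ∀ v, ∫⁻ c, ENNReal.ofReal (v - c) ∂νG ≤
      ∫⁻ c, ENNReal.ofReal (m v - c) ∂νG + 2 * ENNReal.ofReal ((v - m v) * G (m v)) := by
    intro v
    calc ∫⁻ c, ENNReal.ofReal (v - c) ∂νG
        ≤ ∫⁻ c, (ENNReal.ofReal (m v - c) +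
            (Iic v).indicator (fun _ => ENNReal.ofReal (v - m v)) c) ∂νG := by
          refine lintegral_mono fun c => ?_
          by_cases hc : c ≤ v
          · rw [indicator_of_mem (by exact hc)]
            refine le_trans (ENNReal.ofReal_le_ofReal ?_) ENNReal.ofReal_add_le
            linarith
          · rw [ENNReal.ofReal_of_nonpos (by linarith)]; positivity
      _ = ∫⁻ c, ENNReal.ofReal (m v - c) ∂νG + ENNReal.ofReal (v - m v) * νG (Iic v) := by
          rw [lintegral_add_left (by fun_prop), lintegral_indicator_const measurableSet_Iic]
      _ = _ := by
          rw [aux_ofReal νG G hGcdf, show G v = 2 * G (m v) by rw [Gm]; ring,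
            ENNReal.ofReal_mul (by norm_num), ENNReal.ofReal_mul' (Gnn _)]
          simp only [ENNReal.ofReal_ofNat]
          ring
  have mT : Measurable (fun v => ∫⁻ c, ENNReal.ofReal (m v - c) ∂νG) := by
    apply Measurable.lintegral_prod_right' (f := fun p : ℝ × ℝ => ENNReal.ofReal (m p.1 - p.2))
    exact ((mm.comp measurable_fst).sub measurable_snd).ennreal_ofReal
  have main : ENNReal.ofReal FB ≤ ENNReal.ofReal (2 * SP + 2 * BuyerP) := by
    calc ENNReal.ofReal FB
        ≤ ∫⁻ c, (∫⁻ v, ENNReal.ofReal (v - c) ∂νF) ∂νG := by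
          rw [cFB]
          exact lintegral_mono fun c => setLIntegral_le_lintegral _ _
      _ = ∫⁻ v, (∫⁻ c, ENNReal.ofReal (v - c) ∂νG) ∂νF := by
          rw [lintegral_lintegral_swap]
          exact (measurable_snd.sub measurable_fst).ennreal_ofReal.aemeasurable
      _ ≤ ∫⁻ v, (∫⁻ c, ENNReal.ofReal (m v - c) ∂νG +
            2 * ENNReal.ofReal ((v - m v) * G (m v))) ∂νF := lintegral_mono bFB
      _ = ∫⁻ v, ∫⁻ c, ENNReal.ofReal (m v - c) ∂νG ∂νF +
            2 * ∫⁻ v, ENNReal.ofReal ((v - m v) * G (m v)) ∂νF := by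
          rw [lintegral_add_left mT, lintegral_const_mul' _ _ (by simp)]
      _ ≤ 2 * ENNReal.ofReal SP + 2 * ENNReal.ofReal BuyerP := by
          refine add_le_add (key.trans ?_) ?_
          · rw [cSP]
            gcongr 2 * ?_
            refine lintegral_mono_ae ?_
            filter_upwards [haeG] with c hc
            exact bSP c hc
          · rw [cBP]
            gcongr 2 * ?_
            refine lintegral_mono_ae ?_
            filter_upwards [haeF] with v hv
            exact bBP v hv
      _ = _ := by
          rw [ENNReal.ofReal_add (by positivity) (by positivity),
            ENNReal.ofReal_mul (by norm_num), ENNReal.ofReal_mul (by norm_num)]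
          simp
  have := (ENNReal.ofReal_le_ofReal_iff (by positivity)).1 main
  linarith
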